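/- Asymptotic tightness of the cross-entropy lower bound (Lemma 5, second part): take the one-sided bounds l = γΣl* and u = +∞ (componentwise), where l* ∈ ℝ^d with l* > 0 componentwise, and write ℓ(γ) = ∫_{x ≥ γΣl*} φ_Σ(x) dx. Define ℓ_L(γ) = sup over ν ∈ ℝ^d and σ ∈ ℝ^d with σ > 0 of exp(∫_{x ≥ γΣl*} φ̲(x;ν,σ) · log(φ_Σ(x)/φ̲(x;ν,σ)) dx). Then ℓ_L(γ) ≤ ℓ(γ) for all γ, and ℓ_L(γ)/ℓ(γ) → 1 as γ → ∞. -/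

import Mathlib

open MeasureTheory Real Filter Matrix

/-- Standard normal density on ℝ. -/
noncomputable def stdPdf (t : ℝ) : ℝ := (Real.sqrt (2 * Real.pi))⁻¹ * Real.exp (-t ^ 2 / 2)

/-- Standard normal cumulative distribution function Φ. -/
noncomputable def Phi (t : ℝ) : ℝ := ∫ s in Set.Iic t, stdPdf s

/-- Centered Gaussian density with covariance Σ:
φ_Σ(x) = ((2π)^d det Σ)^{-1/2} exp(−xᵀΣ^{-1}x/2). -/
noncomputable def gaussDens {d : ℕ} (S : Matrix (Fin d) (Fin d) ℝ) (x : Fin d → ℝ) : ℝ :=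
  (Real.sqrt ((2 * Real.pi) ^ d * S.det))⁻¹ * Real.exp (-(x ⬝ᵥ S⁻¹.mulVec x) / 2)

/-- Product truncated Gaussian density φ̲(x;ν,σ) with lower bound l and upper bound +∞:
φ̲(x;ν,σ) = Π_k σ_k^{-1}φ((x_k−ν_k)/σ_k)·1{x_k ≥ l_k}/(1 − Φ((l_k−ν_k)/σ_k)). -/
noncomputable def truncProdL {d : ℕ} (l ν σ x : Fin d → ℝ) : ℝ :=
  ∏ k, (σ k)⁻¹ * stdPdf ((x k - ν k) / σ k) *
      (if l k ≤ x k then (1 : ℝ) else 0) / (1 - Phi ((l k - ν k) / σ k))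

/-- One-sided region {x : x ≥ γΣl*}. -/
def regGam {d : ℕ} (S : Matrix (Fin d) (Fin d) ℝ) (lstar : Fin d → ℝ) (γ : ℝ) :
    Set (Fin d → ℝ) := {x | ∀ k, γ * S.mulVec lstar k ≤ x k}

/-- ℓ(γ) = ∫_{x ≥ γΣl*} φ_Σ(x) dx. -/
noncomputable def ellG {d : ℕ} (S : Matrix (Fin d) (Fin d) ℝ) (lstar : Fin d → ℝ)
    (γ : ℝ) : ℝ := ∫ x in regGam S lstar γ, gaussDens S x

/-- The cross-entropy lower bound ℓ_L(γ): the supremum over ν and σ > 0 of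
exp(∫_{x ≥ γΣl*} φ̲(x;ν,σ) log(φ_Σ(x)/φ̲(x;ν,σ)) dx). -/
noncomputable def ellL {d : ℕ} (S : Matrix (Fin d) (Fin d) ℝ) (lstar : Fin d → ℝ)
    (γ : ℝ) : ℝ :=
  sSup {r : ℝ | ∃ ν σ : Fin d → ℝ, (∀ k, 0 < σ k) ∧
    r = Real.exp (∫ x in regGam S lstar γ,
      truncProdL (fun k => γ * S.mulVec lstar k) ν σ x *
        Real.log (gaussDens S x /
          truncProdL (fun k => γ * S.mulVec lstar k) ν σ x))}

section LinearAlgebraBounds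

lemma exists_abs_quadForm_le {d : ℕ} (M : Matrix (Fin d) (Fin d) ℝ) :
    ∃ K : ℝ, 0 < K ∧ ∀ x : Fin d → ℝ, |x ⬝ᵥ M.mulVec x| ≤ K * ∑ k, x k ^ 2 := by
  have hnn : 0 ≤ ∑ i, ∑ j, |M i j| := by positivity
  refine ⟨∑ i, ∑ j, |M i j| + 1, by positivity, fun x => ?_⟩
  have hx : 0 ≤ ∑ k, x k ^ 2 := by positivity
  have hprod (i j : Fin d) : |x i| * |x j| ≤ ∑ k, x k ^ 2 := by
    have hi : x i ^ 2 ≤ ∑ k, x k ^ 2 :=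
      Finset.single_le_sum (f := fun k => x k ^ 2) (fun k _ => sq_nonneg _) (Finset.mem_univ i)
    have hj : x j ^ 2 ≤ ∑ k, x k ^ 2 :=
      Finset.single_le_sum (f := fun k => x k ^ 2) (fun k _ => sq_nonneg _) (Finset.mem_univ j)
    nlinarith [sq_nonneg (|x i| - |x j|), sq_abs (x i), sq_abs (x j)]
  calc |x ⬝ᵥ M.mulVec x| = |∑ i, ∑ j, x i * (M i j * x j)| := by
        simp only [dotProduct, mulVec, Finset.mul_sum]
    _ ≤ ∑ i, ∑ j, |x i * (M i j * x j)| :=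
        (Finset.abs_sum_le_sum_abs _ _).trans
          (Finset.sum_le_sum fun i _ => Finset.abs_sum_le_sum_abs _ _)
    _ ≤ ∑ i, ∑ j, |M i j| * ∑ k, x k ^ 2 := by
        refine Finset.sum_le_sum fun i _ => Finset.sum_le_sum fun j _ => ?_
        rw [abs_mul, abs_mul, mul_left_comm]
        exact mul_le_mul_of_nonneg_left (hprod i j) (abs_nonneg _)
    _ = (∑ i, ∑ j, |M i j|) * ∑ k, x k ^ 2 := by simp only [Finset.sum_mul]
    _ ≤ _ := by nlinarith

variable {d : ℕ} {S : Matrix (Fin d) (Fin d) ℝ}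

lemma Matrix.PosDef.inv_mulVec_mulVec (hS : S.PosDef) (x : Fin d → ℝ) :
    S⁻¹.mulVec (S.mulVec x) = x := by
  rw [mulVec_mulVec, nonsing_inv_mul _ ((isUnit_iff_isUnit_det _).1 hS.isUnit), one_mulVec]

lemma Matrix.PosDef.inv_quadForm_nonneg (hS : S.PosDef) (x : Fin d → ℝ) :
    0 ≤ x ⬝ᵥ S⁻¹.mulVec x := by
  simpa using hS.inv.posSemidef.dotProduct_mulVec_nonneg x

lemma Matrix.PosDef.mulVec_dotProduct_inv_mulVec (hS : S.PosDef) (u x : Fin d → ℝ) :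
    S.mulVec u ⬝ᵥ S⁻¹.mulVec x = u ⬝ᵥ x := by
  have hT : Sᵀ = S := by simpa using hS.isHermitian.eq
  have hdet := (isUnit_iff_isUnit_det _).1 hS.isUnit
  rw [← vecMul_transpose, hT, ← dotProduct_mulVec, mulVec_mulVec, mul_nonsing_inv _ hdet,
    one_mulVec]

/-- Expansion of the quadratic form of `S⁻¹` around the point `S u`. -/
lemma Matrix.PosDef.inv_quadForm_add (hS : S.PosDef) (u y : Fin d → ℝ) :
    (S.mulVec u + y) ⬝ᵥ S⁻¹.mulVec (S.mulVec u + y) =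
      S.mulVec u ⬝ᵥ S⁻¹.mulVec (S.mulVec u) + 2 * (u ⬝ᵥ y) + y ⬝ᵥ S⁻¹.mulVec y := by
  rw [mulVec_add, dotProduct_add, add_dotProduct, add_dotProduct,
    hS.mulVec_dotProduct_inv_mulVec u y, hS.inv_mulVec_mulVec, dotProduct_comm y u]
  ring

lemma Matrix.PosDef.exists_inv_quadForm_ge (hS : S.PosDef) :
    ∃ c : ℝ, 0 < c ∧ ∀ x : Fin d → ℝ, c * ∑ k, x k ^ 2 ≤ x ⬝ᵥ S⁻¹.mulVec x := by
  obtain ⟨K, hK, hKb⟩ := exists_abs_quadForm_le S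
  refine ⟨K⁻¹, by positivity, fun x => ?_⟩
  have hmain := hS.inv_quadForm_nonneg (S.mulVec (-K⁻¹ • x) + x)
  have hxx : x ⬝ᵥ x = ∑ k, x k ^ 2 := by simp [dotProduct, sq]
  rw [hS.inv_quadForm_add, hS.inv_mulVec_mulVec, mulVec_smul, smul_dotProduct,
    dotProduct_smul, smul_dotProduct, hxx, dotProduct_comm] at hmain
  simp only [smul_eq_mul] at hmain
  have hb := (abs_le.1 (hKb x)).2
  have h2 : K⁻¹ * K⁻¹ * (x ⬝ᵥ S.mulVec x) ≤ K⁻¹ * K⁻¹ * (K * ∑ k, x k ^ 2) :=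
    mul_le_mul_of_nonneg_left hb (by positivity)
  have h3 : K⁻¹ * K⁻¹ * (K * ∑ k, x k ^ 2) = K⁻¹ * ∑ k, x k ^ 2 := by field_simp
  linarith

end LinearAlgebraBounds

section Univariate

lemma stdPdf_pos (t : ℝ) : 0 < stdPdf t := by unfold stdPdf; positivity

lemma stdPdf_eq_gaussianPDFReal : stdPdf = ProbabilityTheory.gaussianPDFReal 0 1 := by
  ext t
  simp [stdPdf, ProbabilityTheory.gaussianPDFReal]

lemma integrable_stdPdf : Integrable stdPdf :=
  stdPdf_eq_gaussianPDFReal ▸ ProbabilityTheory.integrable_gaussianPDFReal 0 1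

lemma integral_stdPdf : ∫ t, stdPdf t = 1 :=
  stdPdf_eq_gaussianPDFReal ▸
    ProbabilityTheory.integral_gaussianPDFReal_eq_one 0 one_ne_zero

lemma integrable_stdPdf_mul_one_add_sq : Integrable fun t => stdPdf t * (1 + t ^ 2) := by
  have h := (integrable_exp_neg_mul_sq (b := 1 / 4) (by norm_num)).const_mul
    (5 * (Real.sqrt (2 * Real.pi))⁻¹)
  refine h.mono' (by unfold stdPdf; fun_prop) (Eventually.of_forall fun t => ?_)
  rw [Real.norm_of_nonneg (by have := stdPdf_pos t; positivity), stdPdf]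
  have h1 : t ^ 2 / 4 + 1 ≤ Real.exp (t ^ 2 / 4) := Real.add_one_le_exp _
  have h2 : Real.exp (-t ^ 2 / 2) = Real.exp (-(1 / 4) * t ^ 2) * (Real.exp (t ^ 2 / 4))⁻¹ := by
    rw [← Real.exp_neg, ← Real.exp_add]; ring_nf
  have h3 : (Real.exp (t ^ 2 / 4))⁻¹ * (1 + t ^ 2) ≤ 5 := by
    rw [inv_mul_le_iff₀ (Real.exp_pos _)]; nlinarith [sq_nonneg t]
  rw [h2]
  calc _ = (Real.sqrt (2 * Real.pi))⁻¹ * Real.exp (-(1 / 4) * t ^ 2) *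
        ((Real.exp (t ^ 2 / 4))⁻¹ * (1 + t ^ 2)) := by ring
    _ ≤ (Real.sqrt (2 * Real.pi))⁻¹ * Real.exp (-(1 / 4) * t ^ 2) * 5 :=
        mul_le_mul_of_nonneg_left h3 (by positivity)
    _ = _ := by ring

lemma MeasureTheory.Integrable.comp_standardize {g : ℝ → ℝ} (hg : Integrable g) (ν : ℝ) {σ : ℝ}
    (hσ : 0 < σ) :
    Integrable fun t => g ((t - ν) / σ) :=
  (hg.comp_div hσ.ne').comp_sub_right ν

lemma integral_Ici_standardize (g : ℝ → ℝ) (l ν : ℝ) {σ : ℝ} (hσ : 0 < σ) :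
    ∫ t in Set.Ici l, σ⁻¹ * g ((t - ν) / σ) = ∫ s in Set.Ici ((l - ν) / σ), g s := by
  have hind : (Set.Ici l).indicator (fun t => g ((t - ν) / σ)) =
      fun t => (Set.Ici ((l - ν) / σ)).indicator g ((t - ν) / σ) := by
    ext t
    simp only [Set.indicator, Set.mem_Ici, div_le_div_iff_of_pos_right hσ, sub_le_sub_iff_right]
  rw [integral_const_mul, ← integral_indicator measurableSet_Ici, hind,
    integral_sub_right_eq_self (fun t => (Set.Ici ((l - ν) / σ)).indicator g (t / σ)) ν,
    Measure.integral_comp_div, integral_indicator measurableSet_Ici, smul_eq_mul,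
    abs_of_pos hσ, inv_mul_cancel_left₀ hσ.ne']

lemma one_sub_Phi (a : ℝ) : 1 - Phi a = ∫ t in Set.Ici a, stdPdf t := by
  rw [integral_Ici_eq_integral_Ioi, ← integral_stdPdf,
    ← intervalIntegral.integral_Iic_add_Ioi (b := a) integrable_stdPdf.integrableOn
      integrable_stdPdf.integrableOn, Phi, add_sub_cancel_left]

lemma one_sub_Phi_pos (a : ℝ) : 0 < 1 - Phi a := by
  rw [one_sub_Phi, setIntegral_pos_iff_support_of_nonneg_ae
    (Eventually.of_forall fun t => (stdPdf_pos t).le) integrable_stdPdf.integrableOn]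
  have : Function.support stdPdf = Set.univ := by ext t; simp [(stdPdf_pos t).ne']
  simp [this]

lemma one_sub_Phi_standardize (l ν : ℝ) {σ : ℝ} (hσ : 0 < σ) :
    1 - Phi ((l - ν) / σ) = ∫ t in Set.Ici l, σ⁻¹ * stdPdf ((t - ν) / σ) := by
  rw [integral_Ici_standardize stdPdf l ν hσ, one_sub_Phi]

lemma integrableOn_exp_neg_mul_sub {a : ℝ} (ha : 0 < a) (l : ℝ) :
    IntegrableOn (fun t => Real.exp (-(a * (t - l)))) (Set.Ici l) := by
  have h : IntegrableOn (fun t => Real.exp (-a * t)) (Set.Ici l) := by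
    rw [integrableOn_Ici_iff_integrableOn_Ioi]
    exact integrableOn_exp_mul_Ioi (neg_lt_zero.2 ha) l
  refine IntegrableOn.congr_fun (h.mul_const (Real.exp (a * l))) (fun t _ => ?_) measurableSet_Ici
  rw [← Real.exp_add]; ring_nf

lemma integral_exp_neg_mul_sub {a : ℝ} (ha : 0 < a) (l : ℝ) :
    ∫ t in Set.Ici l, Real.exp (-(a * (t - l))) = a⁻¹ := by
  have h : ∀ t, Real.exp (-(a * (t - l))) = Real.exp (-a * t) * Real.exp (a * l) := fun t => by
    rw [← Real.exp_add]; ring_nf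
  simp only [h]
  rw [integral_mul_const, integral_Ici_eq_integral_Ioi, integral_exp_mul_Ioi (neg_lt_zero.2 ha),
    neg_div_neg_eq, div_mul_eq_mul_div, ← Real.exp_add]
  simp

lemma integrableOn_exp_neg_mul_sub_sq {a b : ℝ} (ha : 0 < a) (hb : 0 ≤ b) (l : ℝ) :
    IntegrableOn (fun t => Real.exp (-(a * (t - l)) - b * (t - l) ^ 2)) (Set.Ici l) := by
  refine (integrableOn_exp_neg_mul_sub ha l).mono' (by fun_prop) (Eventually.of_forall fun t => ?_)
  rw [Real.norm_of_nonneg (Real.exp_pos _).le]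
  exact Real.exp_le_exp.2 (by nlinarith [mul_nonneg hb (sq_nonneg (t - l))])

lemma le_mul_integral_exp_neg_mul_sub_sq {a b : ℝ} (ha : 0 < a) (hb : 0 ≤ b) (l : ℝ) :
    1 - 32 * b / a ^ 2 ≤
      a * ∫ t in Set.Ici l, Real.exp (-(a * (t - l)) - b * (t - l) ^ 2) := by
  have ha2 : 0 < a / 2 := by positivity
  have hpt : ∀ t ∈ Set.Ici l, Real.exp (-(a * (t - l))) -
      16 * b / a ^ 2 * Real.exp (-(a / 2 * (t - l))) ≤
        Real.exp (-(a * (t - l)) - b * (t - l) ^ 2) := by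
    intro t ht
    have hy : 0 ≤ t - l := sub_nonneg.2 ht
    have h1 : 1 - b * (t - l) ^ 2 ≤ Real.exp (-(b * (t - l) ^ 2)) := by
      linarith [Real.add_one_le_exp (-(b * (t - l) ^ 2))]
    have h2 : (a * (t - l) / 4) ^ 2 ≤ Real.exp (a / 2 * (t - l)) := by
      have h4 : a / 2 * (t - l) = a * (t - l) / 4 + a * (t - l) / 4 := by ring
      rw [h4, Real.exp_add, ← sq]
      have := Real.add_one_le_exp (a * (t - l) / 4)
      have : 0 ≤ a * (t - l) / 4 := by positivity
      gcongr
      linarith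
    have h5 : b * (t - l) ^ 2 ≤ 16 * b / a ^ 2 * Real.exp (a / 2 * (t - l)) := by
      calc b * (t - l) ^ 2 = 16 * b / a ^ 2 * (a * (t - l) / 4) ^ 2 := by field_simp; ring
        _ ≤ _ := mul_le_mul_of_nonneg_left h2 (by positivity)
    have h6 : Real.exp (-(a / 2 * (t - l))) =
        Real.exp (-(a * (t - l))) * Real.exp (a / 2 * (t - l)) := by
      rw [← Real.exp_add]; ring_nf
    have h7 := Real.exp_pos (-(a * (t - l)))
    rw [sub_eq_add_neg (-(a * (t - l))), Real.exp_add, h6]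
    nlinarith
  have hmono := setIntegral_mono_on ((integrableOn_exp_neg_mul_sub ha l).sub
    ((integrableOn_exp_neg_mul_sub ha2 l).const_mul (16 * b / a ^ 2)))
    (integrableOn_exp_neg_mul_sub_sq ha hb l) measurableSet_Ici hpt
  have hsub := integral_sub (integrableOn_exp_neg_mul_sub ha l)
    ((integrableOn_exp_neg_mul_sub ha2 l).const_mul (16 * b / a ^ 2))
  rw [integral_const_mul, integral_exp_neg_mul_sub ha, integral_exp_neg_mul_sub ha2] at hsub
  calc 1 - 32 * b / a ^ 2 = a * (a⁻¹ - 16 * b / a ^ 2 * (a / 2)⁻¹) := by field_simp; ring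
    _ ≤ _ := mul_le_mul_of_nonneg_left (hsub ▸ hmono) ha.le

end Univariate

section Product

lemma one_add_sum_le_prod_one_add {ι : Type*} (s : Finset ι) {f : ι → ℝ} (hf : ∀ i, 0 ≤ f i) :
    1 + ∑ i ∈ s, f i ≤ ∏ i ∈ s, (1 + f i) := by
  classical
  induction s using Finset.induction_on with
  | empty => simp
  | insert a s ha ih =>
    rw [Finset.sum_insert ha, Finset.prod_insert ha]
    have hs : 0 ≤ ∑ i ∈ s, f i := Finset.sum_nonneg fun i _ => hf i
    nlinarith [hf a, mul_nonneg (hf a) hs, mul_le_mul_of_nonneg_left ih (hf a)]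

variable {d : ℕ}

lemma measurableSet_pi_Ici (l : Fin d → ℝ) :
    MeasurableSet (Set.univ.pi fun k => Set.Ici (l k)) :=
  MeasurableSet.univ_pi fun _ => measurableSet_Ici

lemma volume_restrict_pi_Ici (l : Fin d → ℝ) :
    (volume : Measure (Fin d → ℝ)).restrict (Set.univ.pi fun k => Set.Ici (l k)) =
      Measure.pi fun k => (volume : Measure ℝ).restrict (Set.Ici (l k)) := by
  rw [volume_pi, Measure.restrict_pi_pi]

lemma setIntegral_pi_Ici_prod (l : Fin d → ℝ) (f : Fin d → ℝ → ℝ) :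
    ∫ x in Set.univ.pi fun k => Set.Ici (l k), ∏ k, f k (x k) =
      ∏ k, ∫ t in Set.Ici (l k), f k t := by
  rw [volume_restrict_pi_Ici, integral_fintype_prod_eq_prod]

lemma integrableOn_pi_Ici_prod {l : Fin d → ℝ} {f : Fin d → ℝ → ℝ}
    (hf : ∀ k, IntegrableOn (f k) (Set.Ici (l k))) :
    IntegrableOn (fun x => ∏ k, f k (x k)) (Set.univ.pi fun k => Set.Ici (l k)) := by
  rw [IntegrableOn, volume_restrict_pi_Ici]
  exact Integrable.fintype_prod_dep hf

lemma regGam_eq_pi_Ici (S : Matrix (Fin d) (Fin d) ℝ) (u : Fin d → ℝ) (γ : ℝ) :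
    regGam S u γ = Set.univ.pi fun k => Set.Ici (γ * S.mulVec u k) := by
  ext x
  simp only [regGam, Set.mem_ofPred_eq, Set.mem_univ_pi, Set.mem_Ici]

end Product

section GaussDens

variable {d : ℕ} {S : Matrix (Fin d) (Fin d) ℝ}

lemma gaussDens_pos (hS : S.PosDef) (x : Fin d → ℝ) : 0 < gaussDens S x := by
  have := hS.det_pos
  unfold gaussDens
  positivity

lemma measurable_gaussDens (S : Matrix (Fin d) (Fin d) ℝ) : Measurable (gaussDens S) := by
  unfold gaussDens dotProduct mulVec dotProduct
  fun_prop

lemma integrable_gaussDens (hS : S.PosDef) : Integrable (gaussDens S) := by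
  obtain ⟨c, hc, hcb⟩ := hS.exists_inv_quadForm_ge
  have h := (Integrable.fintype_prod (ι := Fin d) (f := fun _ t => Real.exp (-(c / 2) * t ^ 2))
    fun _ => integrable_exp_neg_mul_sq (by positivity)).const_mul
      (Real.sqrt ((2 * Real.pi) ^ d * S.det))⁻¹
  refine h.mono' (measurable_gaussDens S).aestronglyMeasurable (Eventually.of_forall fun x => ?_)
  rw [Real.norm_of_nonneg (gaussDens_pos hS x).le, gaussDens, ← Real.exp_sum, ← Finset.mul_sum]
  gcongr
  linarith [hcb x]

lemma log_gaussDens (hS : S.PosDef) (x : Fin d → ℝ) :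
    Real.log (gaussDens S x) = Real.log (Real.sqrt ((2 * Real.pi) ^ d * S.det))⁻¹ -
      x ⬝ᵥ S⁻¹.mulVec x / 2 := by
  have := hS.det_pos
  rw [gaussDens, Real.log_mul (by positivity) (Real.exp_pos _).ne', Real.log_exp]
  ring

/-- Expansion of the Gaussian density around the point `S u`. -/
lemma gaussDens_add (hS : S.PosDef) (u y : Fin d → ℝ) :
    gaussDens S (S.mulVec u + y) =
      gaussDens S (S.mulVec u) * Real.exp (-(u ⬝ᵥ y) - y ⬝ᵥ S⁻¹.mulVec y / 2) := by
  rw [gaussDens, gaussDens, hS.inv_quadForm_add, mul_assoc _ (Real.exp _), ← Real.exp_add]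
  ring_nf

end GaussDens

section TruncatedDensity

variable {d : ℕ}

lemma truncProdL_of_mem {l ν σ x : Fin d → ℝ} (hx : x ∈ Set.univ.pi fun k => Set.Ici (l k)) :
    truncProdL l ν σ x =
      ∏ k, (σ k)⁻¹ * stdPdf ((x k - ν k) / σ k) / (1 - Phi ((l k - ν k) / σ k)) :=
  Finset.prod_congr rfl fun k _ => by rw [if_pos (Set.mem_Ici.1 (hx k trivial)), mul_one]

lemma truncProdL_pos {l ν σ x : Fin d → ℝ} (hσ : ∀ k, 0 < σ k)
    (hx : x ∈ Set.univ.pi fun k => Set.Ici (l k)) : 0 < truncProdL l ν σ x := by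
  rw [truncProdL_of_mem hx]
  exact Finset.prod_pos fun k _ =>
    div_pos (mul_pos (inv_pos.2 (hσ k)) (stdPdf_pos _)) (one_sub_Phi_pos _)

lemma measurable_truncProdL (l ν σ : Fin d → ℝ) : Measurable (truncProdL l ν σ) := by
  have hmeas : Measurable stdPdf := by unfold stdPdf; fun_prop
  refine Finset.measurable_prod _ fun k _ => ?_
  refine Measurable.div_const (Measurable.mul (by fun_prop) ?_) _
  exact Measurable.ite (measurableSet_le measurable_const (measurable_pi_apply k))
    measurable_const measurable_const

lemma integrableOn_truncProdL (l ν : Fin d → ℝ) {σ : Fin d → ℝ} (hσ : ∀ k, 0 < σ k) :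
    IntegrableOn (truncProdL l ν σ) (Set.univ.pi fun k => Set.Ici (l k)) := by
  refine IntegrableOn.congr_fun ?_ (fun x hx => (truncProdL_of_mem hx).symm)
    (measurableSet_pi_Ici l)
  exact integrableOn_pi_Ici_prod (f := fun k t =>
    (σ k)⁻¹ * stdPdf ((t - ν k) / σ k) / (1 - Phi ((l k - ν k) / σ k))) fun k =>
      (((Integrable.comp_standardize integrable_stdPdf (ν k) (hσ k)).const_mul _).div_const
        _).integrableOn

lemma setIntegral_truncProdL (l ν : Fin d → ℝ) {σ : Fin d → ℝ} (hσ : ∀ k, 0 < σ k) :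
    ∫ x in Set.univ.pi fun k => Set.Ici (l k), truncProdL l ν σ x = 1 := by
  rw [setIntegral_congr_fun (measurableSet_pi_Ici l) fun x hx => truncProdL_of_mem hx,
    setIntegral_pi_Ici_prod l fun k t =>
      (σ k)⁻¹ * stdPdf ((t - ν k) / σ k) / (1 - Phi ((l k - ν k) / σ k))]
  refine Finset.prod_eq_one fun k _ => ?_
  rw [integral_div, ← one_sub_Phi_standardize _ _ (hσ k), div_self (one_sub_Phi_pos _).ne']

lemma log_stdPdf (t : ℝ) :
    Real.log (stdPdf t) = Real.log (Real.sqrt (2 * Real.pi))⁻¹ - t ^ 2 / 2 := by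
  rw [stdPdf, Real.log_mul (by positivity) (Real.exp_pos _).ne', Real.log_exp]
  ring

/-- The log-likelihood ratio grows at most quadratically on the truncation region. -/
lemma exists_abs_log_ratio_le {S : Matrix (Fin d) (Fin d) ℝ} (hS : S.PosDef)
    (l ν : Fin d → ℝ) {σ : Fin d → ℝ} (hσ : ∀ k, 0 < σ k) :
    ∃ C : ℝ, 0 ≤ C ∧ ∀ x ∈ Set.univ.pi fun k => Set.Ici (l k),
      |Real.log (gaussDens S x / truncProdL l ν σ x)| ≤
        C * ∏ k, (1 + ((x k - ν k) / σ k) ^ 2) := by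
  obtain ⟨K, hK, hKb⟩ := exists_abs_quadForm_le S⁻¹
  set A : ℝ := Real.log (Real.sqrt ((2 * Real.pi) ^ d * S.det))⁻¹
  set B : Fin d → ℝ := fun k => Real.log ((σ k)⁻¹ / (1 - Phi ((l k - ν k) / σ k))) +
    Real.log (Real.sqrt (2 * Real.pi))⁻¹
  set D : ℝ := ∑ k, 2 * σ k ^ 2
  refine ⟨|A| + |∑ k, B k| + K * ∑ k, 2 * ν k ^ 2 + K * D + 1, by positivity, fun x hx => ?_⟩
  set u : Fin d → ℝ := fun k => (x k - ν k) / σ k with hu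
  have hq : Real.log (truncProdL l ν σ x) = ∑ k, B k - (∑ k, u k ^ 2) / 2 := by
    rw [truncProdL_of_mem hx, Real.log_prod fun k _ =>
      (div_pos (mul_pos (inv_pos.2 (hσ k)) (stdPdf_pos _)) (one_sub_Phi_pos _)).ne',
      Finset.sum_div, ← Finset.sum_sub_distrib]
    refine Finset.sum_congr rfl fun k _ => ?_
    rw [mul_div_right_comm, Real.log_mul
      (div_pos (inv_pos.2 (hσ k)) (one_sub_Phi_pos _)).ne' (stdPdf_pos _).ne', log_stdPdf]
    ring
  have hsum : ∑ k, x k ^ 2 ≤ ∑ k, 2 * ν k ^ 2 + D * ∑ k, u k ^ 2 := by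
    rw [Finset.mul_sum, ← Finset.sum_add_distrib]
    refine Finset.sum_le_sum fun k _ => ?_
    have hx : x k = ν k + σ k * u k := by
      rw [hu]; field_simp [(hσ k).ne']; ring
    have hD : 2 * σ k ^ 2 ≤ D := Finset.single_le_sum (f := fun k => 2 * σ k ^ 2)
      (fun k _ => by positivity) (Finset.mem_univ k)
    rw [hx]
    nlinarith [mul_le_mul_of_nonneg_right hD (sq_nonneg (u k)), sq_nonneg (ν k - σ k * u k)]
  have hU : 0 ≤ ∑ k, u k ^ 2 := by positivity
  have hP := one_add_sum_le_prod_one_add Finset.univ (f := fun k => u k ^ 2)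
    fun k => sq_nonneg _
  have hD0 : 0 ≤ D := by positivity
  have hν0 : 0 ≤ ∑ k, 2 * ν k ^ 2 := by positivity
  rw [Real.log_div (gaussDens_pos hS x).ne' (truncProdL_pos hσ hx).ne', hq, log_gaussDens hS]
  have hmain : |A - x ⬝ᵥ S⁻¹.mulVec x / 2 - (∑ k, B k - (∑ k, u k ^ 2) / 2)| ≤
      |A| + |∑ k, B k| + K * (∑ k, 2 * ν k ^ 2 + D * ∑ k, u k ^ 2) + ∑ k, u k ^ 2 := by
    have h1 := abs_le.1 ((hKb x).trans (mul_le_mul_of_nonneg_left hsum hK.le))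
    have h2 := mul_nonneg hK.le (add_nonneg hν0 (mul_nonneg hD0 hU))
    have h3 := neg_abs_le A
    have h4 := le_abs_self A
    have h5 := neg_abs_le (∑ k, B k)
    have h6 := le_abs_self (∑ k, B k)
    rw [abs_le]
    constructor <;> linarith [h1.1, h1.2]
  refine hmain.trans (le_trans ?_ (mul_le_mul_of_nonneg_left hP (by positivity)))
  have e1 := mul_nonneg (add_nonneg (abs_nonneg A) (abs_nonneg (∑ k, B k))) hU
  have e2 := mul_nonneg (mul_nonneg hK.le hν0) hU
  have e3 := mul_nonneg hK.le hD0
  nlinarith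

lemma integrableOn_truncProdL_mul_log {S : Matrix (Fin d) (Fin d) ℝ} (hS : S.PosDef)
    (l ν : Fin d → ℝ) {σ : Fin d → ℝ} (hσ : ∀ k, 0 < σ k) :
    IntegrableOn (fun x => truncProdL l ν σ x * Real.log (gaussDens S x / truncProdL l ν σ x))
      (Set.univ.pi fun k => Set.Ici (l k)) := by
  obtain ⟨C, hC, hCb⟩ := exists_abs_log_ratio_le hS l ν hσ
  have hdom := (integrableOn_pi_Ici_prod (l := l) (f := fun k t =>
    (σ k)⁻¹ / (1 - Phi ((l k - ν k) / σ k)) *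
      (stdPdf ((t - ν k) / σ k) * (1 + ((t - ν k) / σ k) ^ 2))) fun k =>
        ((Integrable.comp_standardize integrable_stdPdf_mul_one_add_sq (ν k)
          (hσ k)).const_mul _).integrableOn).const_mul C
  refine Integrable.mono' hdom
    ((measurable_truncProdL l ν σ).mul ((measurable_gaussDens S).div
      (measurable_truncProdL l ν σ)).log).aestronglyMeasurable
    ((ae_restrict_iff' (measurableSet_pi_Ici l)).2 (Eventually.of_forall fun x hx => ?_))
  have hpos := truncProdL_pos (ν := ν) hσ hx
  rw [norm_mul, Real.norm_of_nonneg hpos.le, Real.norm_eq_abs]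
  refine (mul_le_mul_of_nonneg_left (hCb x hx) hpos.le).trans_eq ?_
  rw [truncProdL_of_mem hx, mul_left_comm, ← Finset.prod_mul_distrib]
  congr 1
  exact Finset.prod_congr rfl fun k _ => by ring

/-- Jensen's inequality for the cross-entropy functional. -/
lemma exp_setIntegral_truncProdL_mul_log_le {S : Matrix (Fin d) (Fin d) ℝ} (hS : S.PosDef)
    (l ν : Fin d → ℝ) {σ : Fin d → ℝ} (hσ : ∀ k, 0 < σ k) :
    Real.exp (∫ x in Set.univ.pi fun k => Set.Ici (l k),
      truncProdL l ν σ x * Real.log (gaussDens S x / truncProdL l ν σ x)) ≤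
        ∫ x in Set.univ.pi fun k => Set.Ici (l k), gaussDens S x := by
  set R := Set.univ.pi fun k => Set.Ici (l k) with hR
  set c := ∫ x in R, gaussDens S x
  have hp : IntegrableOn (gaussDens S) R := (integrable_gaussDens hS).integrableOn
  have hq := integrableOn_truncProdL l ν hσ
  have hc : 0 < c := by
    rw [setIntegral_pos_iff_support_of_nonneg_ae
      (Eventually.of_forall fun x => (gaussDens_pos hS x).le) hp]
    have hsupp : Function.support (gaussDens S) = Set.univ := by
      ext x; simp [(gaussDens_pos hS x).ne']
    rw [hsupp, Set.univ_inter, hR, volume_pi_pi]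
    exact pos_iff_ne_zero.2 (Finset.prod_ne_zero_iff.2 fun k _ => by simp)
  rw [← Real.le_log_iff_exp_le hc]
  have hle : ∀ x ∈ R, truncProdL l ν σ x * Real.log (gaussDens S x / truncProdL l ν σ x) ≤
      (Real.log c - 1) * truncProdL l ν σ x + c⁻¹ * gaussDens S x := by
    intro x hx
    have hqx := truncProdL_pos (ν := ν) hσ hx
    have hr := div_pos (gaussDens_pos hS x) hqx
    have hlog := Real.log_le_sub_one_of_pos (div_pos hr hc)
    rw [Real.log_div hr.ne' hc.ne'] at hlog
    calc _ ≤ truncProdL l ν σ x *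
          (Real.log c + (gaussDens S x / truncProdL l ν σ x / c - 1)) :=
          mul_le_mul_of_nonneg_left (by linarith) hqx.le
      _ = _ := by field_simp; ring
  have hmono := setIntegral_mono_on (integrableOn_truncProdL_mul_log hS l ν hσ)
    ((hq.const_mul (Real.log c - 1)).add (hp.const_mul c⁻¹)) (measurableSet_pi_Ici l) hle
  have hadd := integral_add (hq.const_mul (Real.log c - 1)) (hp.const_mul c⁻¹)
  rw [integral_const_mul, integral_const_mul, setIntegral_truncProdL l ν hσ] at hadd
  refine hmono.trans (hadd.trans ?_).le
  rw [inv_mul_cancel₀ hc.ne']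
  ring

/-- A pointwise lower bound on the likelihood ratio bounds the cross-entropy functional below. -/
lemma le_exp_setIntegral_truncProdL_mul_log {S : Matrix (Fin d) (Fin d) ℝ} (hS : S.PosDef)
    (l ν : Fin d → ℝ) {σ : Fin d → ℝ} (hσ : ∀ k, 0 < σ k) {C : ℝ} (hC : 0 < C)
    (h : ∀ x ∈ Set.univ.pi fun k => Set.Ici (l k), C * truncProdL l ν σ x ≤ gaussDens S x) :
    C ≤ Real.exp (∫ x in Set.univ.pi fun k => Set.Ici (l k),
      truncProdL l ν σ x * Real.log (gaussDens S x / truncProdL l ν σ x)) := by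
  rw [← Real.log_le_iff_le_exp hC]
  have hmono := setIntegral_mono_on ((integrableOn_truncProdL l ν hσ).mul_const (Real.log C))
    (integrableOn_truncProdL_mul_log hS l ν hσ) (measurableSet_pi_Ici l) fun x hx => by
      have hqx := truncProdL_pos (ν := ν) hσ hx
      exact mul_le_mul_of_nonneg_left
        (Real.log_le_log hC ((le_div_iff₀ hqx).2 (h x hx))) hqx.le
  rwa [integral_mul_const, setIntegral_truncProdL l ν hσ, one_mul] at hmono

/-- With scale `√s` and location `l - s a`, the truncated normal densities are exponential
densities of rate `a` tilted by a quadratic term. -/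
lemma truncProdL_tilted {l : Fin d → ℝ} (a : Fin d → ℝ) {s : ℝ} (hs : 0 < s) {x : Fin d → ℝ}
    (hx : x ∈ Set.univ.pi fun k => Set.Ici (l k)) :
    truncProdL l (fun k => l k - s * a k) (fun _ => Real.sqrt s) x =
      ∏ k, Real.exp (-(a k * (x k - l k)) - (2 * s)⁻¹ * (x k - l k) ^ 2) /
        ∫ t in Set.Ici (l k), Real.exp (-(a k * (t - l k)) - (2 * s)⁻¹ * (t - l k) ^ 2) := by
  have hσ := Real.sqrt_pos.2 hs
  have hfac (k : Fin d) (t : ℝ) : (Real.sqrt s)⁻¹ * stdPdf ((t - (l k - s * a k)) / Real.sqrt s) =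
      (Real.sqrt s)⁻¹ * (Real.sqrt (2 * Real.pi))⁻¹ * Real.exp (-(s * a k ^ 2 / 2)) *
        Real.exp (-(a k * (t - l k)) - (2 * s)⁻¹ * (t - l k) ^ 2) := by
    rw [stdPdf, div_pow, Real.sq_sqrt hs.le, ← mul_assoc, mul_assoc _ (Real.exp _),
      ← Real.exp_add]
    congr 2
    field_simp
    ring
  rw [truncProdL_of_mem hx]
  refine Finset.prod_congr rfl fun k _ => ?_
  rw [one_sub_Phi_standardize _ _ hσ]
  simp only [hfac]
  rw [integral_const_mul, mul_div_mul_left _ _ (by positivity)]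

end TruncatedDensity

section Asymptotics

variable {d : ℕ} {S : Matrix (Fin d) (Fin d) ℝ}

lemma ellL_le_ellG (hS : S.PosDef) (u : Fin d → ℝ) (γ : ℝ) : ellL S u γ ≤ ellG S u γ := by
  refine csSup_le ⟨_, fun _ => 0, fun _ => 1, fun _ => one_pos, rfl⟩ ?_
  rintro _ ⟨ν, σ, hσ, rfl⟩
  rw [ellG, regGam_eq_pi_Ici]
  exact exp_setIntegral_truncProdL_mul_log_le hS _ ν hσ

lemma le_ellL (hS : S.PosDef) (u : Fin d → ℝ) (γ : ℝ) (ν : Fin d → ℝ) {σ : Fin d → ℝ}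
    (hσ : ∀ k, 0 < σ k) {C : ℝ} (hC : 0 < C)
    (h : ∀ x ∈ Set.univ.pi fun k => Set.Ici (γ * S.mulVec u k),
      C * truncProdL (fun k => γ * S.mulVec u k) ν σ x ≤ gaussDens S x) :
    C ≤ ellL S u γ := by
  refine (le_exp_setIntegral_truncProdL_mul_log hS _ ν hσ hC h).trans
    (le_csSup ⟨ellG S u γ, ?_⟩ ⟨ν, σ, hσ, by rw [regGam_eq_pi_Ici]⟩)
  rintro _ ⟨ν, σ, hσ, rfl⟩
  rw [ellG, regGam_eq_pi_Ici]
  exact exp_setIntegral_truncProdL_mul_log_le hS _ ν hσ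

lemma gaussDens_eq_corner (hS : S.PosDef) (u : Fin d → ℝ) (γ : ℝ) (x : Fin d → ℝ) :
    gaussDens S x = gaussDens S (S.mulVec (γ • u)) *
      Real.exp (-(∑ k, γ * u k * (x k - γ * S.mulVec u k)) -
        (x - γ • S.mulVec u) ⬝ᵥ S⁻¹.mulVec (x - γ • S.mulVec u) / 2) := by
  have h := gaussDens_add hS (γ • u) (x - γ • S.mulVec u)
  rw [mulVec_smul, add_sub_cancel] at h
  rw [h, mulVec_smul]
  simp [dotProduct]

/-- Mills-type upper bound on the orthant probability. -/
lemma ellG_le (hS : S.PosDef) {u : Fin d → ℝ} (hu : ∀ k, 0 < u k) {γ : ℝ} (hγ : 0 < γ) :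
    ellG S u γ ≤ gaussDens S (S.mulVec (γ • u)) * ∏ k, (γ * u k)⁻¹ := by
  set l : Fin d → ℝ := fun k => γ * S.mulVec u k
  have ha (k : Fin d) : 0 < γ * u k := mul_pos hγ (hu k)
  have hexp := (integrableOn_pi_Ici_prod (l := l)
    (f := fun k t => Real.exp (-(γ * u k * (t - l k))))
    fun k => integrableOn_exp_neg_mul_sub (ha k) (l k)).const_mul
      (gaussDens S (S.mulVec (γ • u)))
  have hmono := setIntegral_mono_on (integrable_gaussDens hS).integrableOn hexp
    (measurableSet_pi_Ici l) fun x _ => by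
      rw [gaussDens_eq_corner hS u γ x, ← Real.exp_sum, Finset.sum_neg_distrib]
      refine mul_le_mul_of_nonneg_left (Real.exp_le_exp.2 ?_) (gaussDens_pos hS _).le
      linarith [hS.inv_quadForm_nonneg (x - γ • S.mulVec u)]
  rw [integral_const_mul,
    setIntegral_pi_Ici_prod l fun k t => Real.exp (-(γ * u k * (t - l k)))] at hmono
  simp only [integral_exp_neg_mul_sub (ha _)] at hmono
  rwa [ellG, regGam_eq_pi_Ici]

lemma exists_ellL_ge (hS : S.PosDef) :
    ∃ b : ℝ, 0 < b ∧ ∀ u : Fin d → ℝ, (∀ k, 0 < u k) → ∀ γ : ℝ, 0 < γ →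
      gaussDens S (S.mulVec (γ • u)) * ∏ k, ∫ t in Set.Ici (γ * S.mulVec u k),
        Real.exp (-(γ * u k * (t - γ * S.mulVec u k)) - b * (t - γ * S.mulVec u k) ^ 2) ≤
          ellL S u γ := by
  obtain ⟨K, hK, hKb⟩ := exists_abs_quadForm_le S⁻¹
  refine ⟨K / 2, by positivity, fun u hu γ hγ => ?_⟩
  have hs : 0 < K⁻¹ := inv_pos.2 hK
  have hb : (2 * K⁻¹)⁻¹ = K / 2 := by field_simp
  set l : Fin d → ℝ := fun k => γ * S.mulVec u k
  have hZ (k : Fin d) : 0 < ∫ t in Set.Ici (l k),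
      Real.exp (-(γ * u k * (t - l k)) - K / 2 * (t - l k) ^ 2) := by
    rw [setIntegral_pos_iff_support_of_nonneg_ae
      (Eventually.of_forall fun t => (Real.exp_pos _).le)
      (integrableOn_exp_neg_mul_sub_sq (mul_pos hγ (hu k)) (by positivity) _)]
    simp [Function.support, Real.exp_ne_zero]
  refine le_ellL hS u γ (fun k => l k - K⁻¹ * (γ * u k)) (fun _ => Real.sqrt_pos.2 hs)
    (mul_pos (gaussDens_pos hS _) (Finset.prod_pos fun k _ => hZ k)) fun x hx => ?_
  rw [truncProdL_tilted (fun k => γ * u k) hs hx, hb, mul_assoc, ← Finset.prod_mul_distrib,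
    Finset.prod_congr rfl fun k _ => mul_div_cancel₀ _ (hZ k).ne', ← Real.exp_sum,
    gaussDens_eq_corner hS u γ x, Finset.sum_sub_distrib, Finset.sum_neg_distrib,
    ← Finset.mul_sum]
  refine mul_le_mul_of_nonneg_left (Real.exp_le_exp.2 ?_) (gaussDens_pos hS _).le
  have h := (abs_le.1 (hKb (x - γ • S.mulVec u))).2
  simp only [Pi.sub_apply, Pi.smul_apply, smul_eq_mul] at h
  linarith

end Asymptotics

/-- Lemma 5, second part: with l = γΣl*, u = +∞ and l* > 0 componentwise,
ℓ_L(γ) ≤ ℓ(γ) for all γ, and ℓ_L(γ)/ℓ(γ) → 1 as γ → ∞. -/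
theorem cross_entropy_bound_asymptotically_tight {d : ℕ} (hd : 1 ≤ d)
    (S : Matrix (Fin d) (Fin d) ℝ) (hS : S.PosDef)
    (lstar : Fin d → ℝ) (hlstar : ∀ k, 0 < lstar k) :
    (∀ γ : ℝ, ellL S lstar γ ≤ ellG S lstar γ) ∧
    Tendsto (fun γ : ℝ => ellL S lstar γ / ellG S lstar γ) atTop (nhds 1) := by
  refine ⟨ellL_le_ellG hS lstar, ?_⟩
  obtain ⟨b, hb, hL⟩ := exists_ellL_ge hS
  have hlim : Tendsto (fun γ : ℝ => ∏ k, (1 - 32 * b / (γ * lstar k) ^ 2)) atTop (nhds 1) := by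
    have hk (k : Fin d) :
        Tendsto (fun γ : ℝ => 1 - 32 * b / (γ * lstar k) ^ 2) atTop (nhds 1) := by
      have hsq : Tendsto (fun γ : ℝ => (γ * lstar k) ^ 2) atTop atTop :=
        (tendsto_pow_atTop two_ne_zero).comp (tendsto_id.atTop_mul_const (hlstar k))
      simpa using (hsq.const_div_atTop (32 * b)).const_sub 1
    simpa using tendsto_finsetProd Finset.univ fun k _ => hk k
  have hnn : ∀ᶠ γ : ℝ in atTop, ∀ k, 0 ≤ 1 - 32 * b / (γ * lstar k) ^ 2 := by
    refine eventually_all.2 fun k => ?_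
    have hsq : Tendsto (fun γ : ℝ => (γ * lstar k) ^ 2) atTop atTop :=
      (tendsto_pow_atTop two_ne_zero).comp (tendsto_id.atTop_mul_const (hlstar k))
    filter_upwards [(hsq.const_div_atTop (32 * b)).eventually_lt_const one_pos] with γ hγ
    linarith
  refine tendsto_of_tendsto_of_tendsto_of_le_of_le' hlim tendsto_const_nhds ?_ ?_
  · filter_upwards [hnn, eventually_gt_atTop 0] with γ hγnn hγ
    have hpos : 0 < ellG S lstar γ := (Real.exp_pos _).trans_le
      (regGam_eq_pi_Ici S lstar γ ▸ exp_setIntegral_truncProdL_mul_log_le hS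
        (fun k => γ * S.mulVec lstar k) 0 (σ := fun _ => 1) fun _ => one_pos)
    have hp := gaussDens_pos hS (S.mulVec (γ • lstar))
    have ha (k : Fin d) : 0 < γ * lstar k := mul_pos hγ (hlstar k)
    rw [le_div_iff₀ hpos]
    calc _ ≤ (∏ k, (1 - 32 * b / (γ * lstar k) ^ 2)) *
          (gaussDens S (S.mulVec (γ • lstar)) * ∏ k, (γ * lstar k)⁻¹) :=
          mul_le_mul_of_nonneg_left (ellG_le hS hlstar hγ) (Finset.prod_nonneg fun k _ => hγnn k)
      _ = gaussDens S (S.mulVec (γ • lstar)) *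
          ∏ k, ((1 - 32 * b / (γ * lstar k) ^ 2) * (γ * lstar k)⁻¹) := by
          rw [Finset.prod_mul_distrib]; ring
      _ ≤ _ := by
          refine mul_le_mul_of_nonneg_left (Finset.prod_le_prod (fun k _ =>
            mul_nonneg (hγnn k) (inv_pos.2 (ha k)).le) fun k _ => ?_) hp.le
          rw [mul_inv_le_iff₀ (ha k), mul_comm _ (γ * lstar k)]
          exact le_mul_integral_exp_neg_mul_sub_sq (ha k) hb.le (γ * S.mulVec lstar k)
      _ ≤ _ := hL lstar hlstar γ hγ
  · filter_upwards with γ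
    exact div_le_one_of_le₀ (ellL_le_ellG hS lstar γ)
      (setIntegral_nonneg_of_ae (Eventually.of_forall fun x => (gaussDens_pos hS x).le))
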